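/- Let R be an Abelian periodic ring (every idempotent of R is central and R is periodic) and let n be a positive integer. If every element of the Jacobson radical of the matrix ring Mₙ(R) (Matrix (Fin n) (Fin n) R) is nilpotent, then Mₙ(R) is a periodic ring. -/

import Mathlib

/-- A ring `R` is *periodic* if for every `x ∈ R` there exist positive integers
`m > n` with `x ^ m = x ^ n`. -/
def IsPeriodicRing (R : Type*) [Ring R] : Prop :=
  ∀ x : R, ∃ m n : ℕ, 0 < n ∧ n < m ∧ x ^ m = x ^ n

open Polynomial

section Finiteness

/-- A subring of a ring of positive characteristic is finite if it is finitely generated as an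
additive group. -/
theorem Subalgebra.finite_of_fg_of_natCast_eq_zero {B : Type*} [Ring B] {c : ℕ} (hc : 0 < c)
    (hcB : (c : B) = 0) (S : Subalgebra ℤ B) (hS : S.toSubmodule.FG) : Finite S := by
  have : Module.Finite ℤ S := Module.Finite.of_fg hS
  refine Module.finite_of_fg_torsion S fun {x} ↦ ?_
  refine ⟨⟨(c : ℤ), mem_nonZeroDivisors_of_ne_zero (by exact_mod_cast hc.ne')⟩, ?_⟩
  apply Subtype.ext
  change (c : ℤ) • (x : B) = 0
  rw [zsmul_eq_mul, Int.cast_natCast, hcB, zero_mul]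

theorem isIntegral_int_of_isNilpotent_pow_sub_pow {B : Type*} [Ring B] {x : B} {m k : ℕ}
    (hkm : k < m) (h : IsNilpotent (x ^ m - x ^ k)) : IsIntegral ℤ x := by
  obtain ⟨t, ht⟩ := h
  refine ⟨(X ^ m - X ^ k) ^ t, (monic_X_pow_sub ?_).pow t, ?_⟩
  · rw [degree_X_pow]
    exact_mod_cast hkm
  · rw [← aeval_def]
    simpa using ht

theorem IsPeriodicRing.of_finite (S : Type*) [Ring S] [Finite S] : IsPeriodicRing S := by
  intro x
  obtain ⟨i, j, hij, h⟩ := Finite.exists_ne_map_eq_of_infinite fun i : ℕ ↦ x ^ (i + 1)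
  rcases lt_or_gt_of_ne hij with hlt | hlt
  · exact ⟨j + 1, i + 1, by omega, by omega, h.symm⟩
  · exact ⟨i + 1, j + 1, by omega, by omega, h⟩

theorem IsPeriodicRing.of_surjective {R S : Type*} [Ring R] [Ring S] (hR : IsPeriodicRing R)
    (f : R →+* S) (hf : Function.Surjective f) : IsPeriodicRing S := by
  intro y
  obtain ⟨x, rfl⟩ := hf y
  obtain ⟨m, k, hk, hkm, h⟩ := hR x
  exact ⟨m, k, hk, hkm, by rw [← map_pow, h, map_pow]⟩

theorem IsPeriodicRing.exists_natCast_eq_zero {R : Type*} [Ring R] (hR : IsPeriodicRing R) :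
    ∃ c : ℕ, 0 < c ∧ (c : R) = 0 := by
  obtain ⟨m, k, -, hkm, h⟩ := hR 2
  have hlt : 2 ^ k < 2 ^ m := Nat.pow_lt_pow_right (by norm_num) hkm
  refine ⟨2 ^ m - 2 ^ k, Nat.sub_pos_of_lt hlt, ?_⟩
  rw [Nat.cast_sub hlt.le]
  push_cast
  rw [h, sub_self]

theorem IsPeriodicRing.isIntegral_int {R : Type*} [Ring R] (hR : IsPeriodicRing R) (x : R) :
    IsIntegral ℤ x := by
  obtain ⟨m, k, -, hkm, h⟩ := hR x
  exact isIntegral_int_of_isNilpotent_pow_sub_pow hkm (by rw [h, sub_self]; exact .zero)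

/-- In a ring of positive characteristic, an element that is integral over `ℤ` has repeating
powers. -/
theorem IsIntegral.exists_pow_eq_pow {B : Type*} [Ring B] {c : ℕ} (hc : 0 < c)
    (hcB : (c : B) = 0) {x : B} (hx : IsIntegral ℤ x) :
    ∃ m k : ℕ, 0 < k ∧ k < m ∧ x ^ m = x ^ k := by
  have := (Algebra.adjoin ℤ {x}).finite_of_fg_of_natCast_eq_zero hc hcB hx.fg_adjoin_singleton
  obtain ⟨m, k, hk, hkm, h⟩ := IsPeriodicRing.of_finite (Algebra.adjoin ℤ {x})
    ⟨x, Algebra.self_mem_adjoin_singleton ℤ x⟩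
  exact ⟨m, k, hk, hkm, congrArg Subtype.val h⟩

/-- Square matrices over a commutative periodic ring form a periodic ring. -/
theorem IsPeriodicRing.matrix_of_commRing {K : Type*} [CommRing K] (hK : IsPeriodicRing K)
    (ι : Type*) [Fintype ι] [DecidableEq ι] : IsPeriodicRing (Matrix ι ι K) := by
  intro A
  obtain ⟨c, hc, hcK⟩ := hK.exists_natCast_eq_zero
  let s : Set K := Set.range fun p : ι × ι ↦ A p.1 p.2
  have : Finite (Algebra.adjoin ℤ s) :=
    (Algebra.adjoin ℤ s).finite_of_fg_of_natCast_eq_zero hc hcK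
      (fg_adjoin_of_finite (Set.finite_range _) fun x _ ↦ hK.isIntegral_int x)
  let B : Matrix ι ι (Algebra.adjoin ℤ s) :=
    Matrix.of fun i j ↦ ⟨A i j, Algebra.subset_adjoin ⟨(i, j), rfl⟩⟩
  let f := (Algebra.adjoin ℤ s).val.toRingHom.mapMatrix (m := ι)
  have hB : f B = A := rfl
  obtain ⟨m, k, hk, hkm, h⟩ := IsPeriodicRing.of_finite _ B
  exact ⟨m, k, hk, hkm, by rw [← hB, ← map_pow, h, map_pow]⟩

end Finiteness

section PeriodicDomain

/-- If a product of linear factors in an endomorphism kills a nonzero vector, then one of the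
roots is an eigenvalue. -/
theorem Module.End.exists_eq_smul_of_aeval_prod_eq_zero {K V : Type*} [CommRing K]
    [AddCommGroup V] [Module K V] (f : Module.End K V) (s : Finset K) {v : V} (hv : v ≠ 0)
    (h : aeval f (∏ c ∈ s, (X - C c)) v = 0) : ∃ c ∈ s, ∃ w, w ≠ 0 ∧ f w = c • w := by
  classical
  induction s using Finset.induction_on generalizing v with
  | empty => simp [hv] at h
  | insert c s hcs ih =>
    by_cases hw : f v - c • v = 0
    · exact ⟨c, Finset.mem_insert_self c s, v, hv, sub_eq_zero.mp hw⟩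
    · rw [Finset.prod_insert hcs, mul_comm, map_mul, Module.End.mul_apply] at h
      obtain ⟨d, hd, w, hw⟩ := ih hw (by simpa [Module.algebraMap_end_apply] using h)
      exact ⟨d, Finset.mem_insert_of_mem hd, w, hw⟩

/-- If an element `φ a` of a finite subfield is not central, then some nonzero `z` intertwines it
with a different element of the subfield. -/
theorem exists_mul_eq_mul_of_finite_field {K D : Type*} [Field K] [Finite K] [Ring D]
    (φ : K →+* D) {a : K} {y : D} (hy : y * φ a ≠ φ a * y) :
    ∃ c z, c ≠ a ∧ z ≠ 0 ∧ z * φ a = φ c * z := by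
  classical
  have := Fintype.ofFinite K
  let : Module K D := Module.compHom D φ
  have smul_def : ∀ (c : K) (x : D), c • x = φ c * x := fun _ _ ↦ rfl
  let f : Module.End K D :=
    { toFun := fun x ↦ x * φ a
      map_add' := fun _ _ ↦ add_mul _ _ _
      map_smul' := fun _ _ ↦ mul_assoc _ _ _ }
  have hf : ∀ x, f x = x * φ a := fun _ ↦ rfl
  have hfpow : ∀ (i : ℕ) x, (f ^ i) x = x * φ a ^ i := by
    intro i
    induction i with
    | zero => simp
    | succ i ih => intro x; rw [pow_succ, Module.End.mul_apply, ih, hf, pow_succ', mul_assoc]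
  have hprod : ∏ c : K, (X - C c) = X ^ Fintype.card K - X := by
    have hdeg := FiniteField.X_pow_card_sub_X_natDegree_eq K (Fintype.one_lt_card (α := K))
    have hmonic : (X ^ Fintype.card K - X : K[X]).Monic := by
      refine monic_X_pow_sub ?_
      rw [degree_X]
      exact_mod_cast Fintype.one_lt_card (α := K)
    have := prod_multiset_X_sub_C_of_monic_of_roots_card_eq hmonic (by
      rw [FiniteField.roots_X_pow_card_sub_X, hdeg]; rfl)
    rwa [FiniteField.roots_X_pow_card_sub_X] at this
  have hzero : aeval f (∏ c : K, (X - C c)) = 0 := by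
    ext x
    rw [hprod]
    rw [map_sub, aeval_X_pow, aeval_X, LinearMap.sub_apply, hfpow, hf, ← map_pow,
      FiniteField.pow_card, sub_self, LinearMap.zero_apply]
  rw [← Finset.prod_erase_mul _ _ (Finset.mem_univ a), map_mul] at hzero
  obtain ⟨c, hc, z, hz, h⟩ := f.exists_eq_smul_of_aeval_prod_eq_zero
    (Finset.univ.erase a) (sub_ne_zero.mpr hy) (by
      simpa [Module.algebraMap_end_apply, hf, smul_def] using LinearMap.congr_fun hzero y)
  exact ⟨c, z, Finset.ne_of_mem_erase hc, hz, h⟩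

/-- Two elements of a finite submonoid of a domain of positive characteristic commute. -/
theorem Submonoid.commute_of_finite_of_isDomain {D : Type*} [Ring D] [IsDomain D] {c : ℕ}
    (hc : 0 < c) (hcD : (c : D) = 0) (M : Submonoid D) (hM : (M : Set D).Finite) {x y : D}
    (hx : x ∈ M) (hy : y ∈ M) : Commute x y := by
  have : Finite (Algebra.adjoin ℤ (M : Set D)) := by
    refine (Algebra.adjoin ℤ (M : Set D)).finite_of_fg_of_natCast_eq_zero hc hcD ?_
    rw [Algebra.adjoin_eq_span, Submonoid.closure_eq]
    exact Submodule.fg_span hM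
  exact congrArg Subtype.val <| (Finite.isDomain_to_isField (Algebra.adjoin ℤ (M : Set D))).mul_comm
    ⟨x, Algebra.subset_adjoin hx⟩ ⟨y, Algebra.subset_adjoin hy⟩

theorem IsPeriodicRing.exists_pow_eq_one {D : Type*} [Ring D] [IsDomain D]
    (hD : IsPeriodicRing D) {z : D} (hz : z ≠ 0) : ∃ N, 0 < N ∧ z ^ N = 1 := by
  obtain ⟨m, k, -, hkm, h⟩ := hD z
  refine ⟨m - k, by omega, mul_right_cancel₀ (pow_ne_zero k hz) ?_⟩
  rw [← pow_add, Nat.sub_add_cancel hkm.le, h, one_mul]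

/-- The products `g * z ^ l` with `g ∈ S`, where `z` normalizes `S`. -/
def Subalgebra.mulPowers {D : Type*} [Ring D] (S : Subalgebra ℤ D) (z : D)
    (hz : ∀ g ∈ S, ∃ g' ∈ S, z * g = g' * z) : Submonoid D where
  carrier := {x | ∃ g ∈ S, ∃ l : ℕ, g * z ^ l = x}
  one_mem' := ⟨1, S.one_mem, 0, by simp⟩
  mul_mem' := by
    have hpow : ∀ (l : ℕ), ∀ g ∈ S, ∃ g' ∈ S, z ^ l * g = g' * z ^ l := by
      intro l
      induction l with
      | zero => exact fun g hg ↦ ⟨g, hg, by simp⟩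
      | succ l ih =>
        intro g hg
        obtain ⟨g₁, hg₁, h₁⟩ := hz g hg
        obtain ⟨g₂, hg₂, h₂⟩ := ih g₁ hg₁
        exact ⟨g₂, hg₂, by rw [pow_succ, mul_assoc, h₁, ← mul_assoc, h₂, mul_assoc]⟩
    rintro _ _ ⟨g, hg, l, rfl⟩ ⟨h, hh, r, rfl⟩
    obtain ⟨h', hh', e⟩ := hpow l h hh
    refine ⟨g * h', S.mul_mem hg hh', l + r, ?_⟩
    rw [pow_add, mul_assoc, ← mul_assoc h', ← e]
    simp only [mul_assoc]

theorem Subalgebra.finite_mulPowers {D : Type*} [Ring D] (S : Subalgebra ℤ D) [Finite S] (z : D)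
    (hz : ∀ g ∈ S, ∃ g' ∈ S, z * g = g' * z) {N : ℕ} (hN : 0 < N) (hzN : z ^ N = 1) :
    (S.mulPowers z hz : Set D).Finite := by
  refine (Set.finite_range fun p : S × Fin N ↦ (p.1 : D) * z ^ (p.2 : ℕ)).subset ?_
  rintro _ ⟨g, hg, l, rfl⟩
  exact ⟨(⟨g, hg⟩, ⟨l % N, Nat.mod_lt l hN⟩), by simp [← pow_eq_pow_mod l hzN]⟩

/-- A periodic domain is commutative. -/
theorem IsPeriodicRing.commute_of_isDomain {D : Type*} [Ring D] [IsDomain D]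
    (hD : IsPeriodicRing D) (y a : D) : Commute y a := by
  by_contra hya
  obtain ⟨c, hc, hcD⟩ := hD.exists_natCast_eq_zero
  let S := Algebra.adjoin ℤ {a}
  have haS : a ∈ S := Algebra.self_mem_adjoin_singleton ℤ a
  have : Finite S :=
    S.finite_of_fg_of_natCast_eq_zero hc hcD (hD.isIntegral_int a).fg_adjoin_singleton
  obtain ⟨⟨b, hb⟩, z, hba, hz, hzab⟩ :
      ∃ (b : S) (z : D), b ≠ ⟨a, haS⟩ ∧ z ≠ 0 ∧ z * a = b * z := by
    let := (Finite.isDomain_to_isField S).toField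
    exact exists_mul_eq_mul_of_finite_field (S.val : S →+* D) (a := ⟨a, haS⟩) hya
  have hnorm : ∀ g ∈ S, ∃ g' ∈ S, z * g = g' * z := by
    intro g hg
    induction hg using Algebra.adjoin_induction with
    | mem x hx => exact ⟨b, hb, by rwa [Set.mem_singleton_iff.mp hx]⟩
    | algebraMap r => exact ⟨_, S.algebraMap_mem r, (Algebra.commutes r z).symm⟩
    | add x y _ _ hx hy =>
      obtain ⟨x', hx', ex⟩ := hx
      obtain ⟨y', hy', ey⟩ := hy
      exact ⟨x' + y', S.add_mem hx' hy', by rw [mul_add, ex, ey, add_mul]⟩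
    | mul x y _ _ hx hy =>
      obtain ⟨x', hx', ex⟩ := hx
      obtain ⟨y', hy', ey⟩ := hy
      exact ⟨x' * y', S.mul_mem hx' hy', by rw [← mul_assoc, ex, mul_assoc, ey, mul_assoc]⟩
  obtain ⟨N, hN, hzN⟩ := hD.exists_pow_eq_one hz
  have hcomm : Commute a z := (S.mulPowers z hnorm).commute_of_finite_of_isDomain hc hcD
    (S.finite_mulPowers z hnorm hN hzN) ⟨a, haS, 0, by simp⟩ ⟨1, S.one_mem, 1, by simp⟩
  exact hba (Subtype.ext (mul_right_cancel₀ hz (hzab.symm.trans hcomm.eq.symm)))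

end PeriodicDomain

section AbelianPeriodic

variable {R : Type*} [Ring R]

theorem IsPeriodicRing.exists_isIdempotentElem_pow (hper : IsPeriodicRing R) (x : R) :
    ∃ N, 0 < N ∧ IsIdempotentElem (x ^ N) := by
  obtain ⟨m, k, hk, hkm, h⟩ := hper x
  have hadd : ∀ i t : ℕ, x ^ (k + i + t * (m - k)) = x ^ (k + i) := by
    intro i t
    induction t with
    | zero => simp
    | succ t ih =>
      rw [show k + i + (t + 1) * (m - k) = m + (i + t * (m - k)) by rw [add_mul]; omega,
        pow_add, h, ← pow_add, ← add_assoc, ih]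
  have hle : k ≤ k * (m - k) := Nat.le_mul_of_pos_right k (by omega)
  refine ⟨k * (m - k), by omega, ?_⟩
  have := hadd (k * (m - k) - k) k
  rw [Nat.add_sub_cancel' hle] at this
  rw [IsIdempotentElem, ← pow_add, this]

/-- In an Abelian periodic ring every nilpotent element lies in the Jacobson radical. -/
theorem IsPeriodicRing.mem_jacobson_of_isNilpotent (hper : IsPeriodicRing R)
    (hab : ∀ e : R, e * e = e → ∀ x : R, e * x = x * e) {x : R} (hx : IsNilpotent x) :
    x ∈ Ideal.jacobson (⊥ : Ideal R) := by
  rw [Ideal.mem_jacobson_iff]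
  intro y
  obtain ⟨N, hN, he⟩ := hper.exists_isIdempotentElem_pow (y * x)
  obtain ⟨s, hs⟩ : ∃ s, (y * x) ^ N = s * x := by
    obtain ⟨N, rfl⟩ := Nat.exists_eq_add_of_lt hN
    exact ⟨(y * x) ^ (0 + N) * y, by rw [pow_succ, mul_assoc]⟩
  have hpow : ∀ t : ℕ, (y * x) ^ N = s ^ (t + 1) * x ^ (t + 1) := by
    intro t
    induction t with
    | zero => simpa using hs
    | succ t ih =>
      calc (y * x) ^ N = (s ^ (t + 1) * x ^ (t + 1)) * (y * x) ^ N := by rw [← ih, he.eq]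
        _ = s ^ (t + 1) * ((y * x) ^ N * x ^ (t + 1)) := by
          rw [mul_assoc, hab _ he.eq (x ^ (t + 1))]
        _ = s ^ (t + 1 + 1) * x ^ (t + 1 + 1) := by
          rw [hs, pow_succ s (t + 1), pow_succ' x (t + 1)]
          simp only [mul_assoc]
  obtain ⟨t, ht⟩ := hx
  have hnil : IsNilpotent (y * x) := ⟨N, by rw [hpow t, pow_succ x, ht, zero_mul, mul_zero]⟩
  obtain ⟨u, hu⟩ := hnil.isUnit_add_one
  refine ⟨↑u⁻¹, ?_⟩
  have : (↑u⁻¹ : R) * (y * x + 1) = 1 := by rw [← hu, Units.inv_mul]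
  rw [mul_add, mul_one, ← mul_assoc] at this
  rw [this, sub_self]
  exact Ideal.zero_mem _

/-- Maximal left ideals of an Abelian periodic ring are two-sided. -/
theorem IsPeriodicRing.isTwoSided_of_isMaximal (hper : IsPeriodicRing R)
    (hab : ∀ e : R, e * e = e → ∀ x : R, e * x = x * e) (M : Ideal R) [M.IsMaximal] :
    M.IsTwoSided := by
  refine ⟨fun {x} r hx ↦ ?_⟩
  obtain ⟨N, hN, he⟩ := hper.exists_isIdempotentElem_pow x
  have hcen := hab _ he.eq
  have heM : x ^ N ∈ M := by
    obtain ⟨N, rfl⟩ := Nat.exists_eq_add_of_lt hN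
    rw [pow_succ]
    exact M.mul_mem_left _ hx
  have hnil : IsNilpotent (x * (1 - x ^ N)) := by
    refine ⟨N, ?_⟩
    have hcomm : Commute x (1 - x ^ N) := (Commute.one_right x).sub_right (Commute.self_pow x N)
    rw [hcomm.mul_pow, he.one_sub.pow_eq hN.ne', mul_sub, mul_one, he.eq, sub_self]
  have hJ : x * (1 - x ^ N) * r ∈ Ideal.jacobson (⊥ : Ideal R) :=
    Ideal.mul_mem_right _ _ (hper.mem_jacobson_of_isNilpotent hab hnil)
  have hJM : Ideal.jacobson (⊥ : Ideal R) ≤ M := sInf_le ⟨bot_le, ‹_›⟩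
  have hsplit : x * r = x * (1 - x ^ N) * r + x * r * x ^ N := by
    rw [mul_assoc x r, ← hcen r]
    noncomm_ring
  rw [hsplit]
  exact M.add_mem (hJM hJ) (M.mul_mem_left _ heM)

theorem Ideal.IsMaximal.isDomain_quotient_of_isTwoSided (M : Ideal R) [hM : M.IsMaximal]
    [M.IsTwoSided] : IsDomain (R ⧸ M) := by
  have : Nontrivial (R ⧸ M) := Ideal.Quotient.nontrivial_iff.mpr hM.ne_top
  have : NoZeroDivisors (R ⧸ M) := by
    refine ⟨fun {a b} h ↦ ?_⟩
    obtain ⟨x, rfl⟩ := Ideal.Quotient.mk_surjective a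
    obtain ⟨y, rfl⟩ := Ideal.Quotient.mk_surjective b
    rw [← map_mul] at h
    rw [Ideal.Quotient.eq_zero_iff_mem] at h ⊢
    rw [Ideal.Quotient.eq_zero_iff_mem]
    refine or_iff_not_imp_left.mpr fun hx ↦ ?_
    obtain ⟨r, i, hi, hri⟩ := hM.exists_inv hx
    have hy : y = r * (x * y) + i * y := by rw [← mul_assoc, ← add_mul, hri, one_mul]
    rw [hy]
    exact M.add_mem (M.mul_mem_left r h) (M.mul_mem_right y hi)
  exact NoZeroDivisors.to_isDomain _

/-- An Abelian periodic ring is commutative modulo its Jacobson radical. -/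
theorem IsPeriodicRing.mul_sub_mul_mem_jacobson (hper : IsPeriodicRing R)
    (hab : ∀ e : R, e * e = e → ∀ x : R, e * x = x * e) (x y : R) :
    x * y - y * x ∈ Ideal.jacobson (⊥ : Ideal R) := by
  refine Submodule.mem_sInf.mpr ?_
  rintro M ⟨-, hM⟩
  have := hper.isTwoSided_of_isMaximal hab M
  have := Ideal.IsMaximal.isDomain_quotient_of_isTwoSided M
  have hD := hper.of_surjective (Ideal.Quotient.mk M) Ideal.Quotient.mk_surjective
  rw [← Ideal.Quotient.eq_zero_iff_mem, map_sub, map_mul, map_mul,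
    (hD.commute_of_isDomain _ _).eq, sub_self]

end AbelianPeriodic

/-- Let `R` be an Abelian periodic ring (all idempotents are central). If the
Jacobson radical of `Mₙ(R)` is nil for some `n ≥ 1`, then `Mₙ(R)` is periodic. -/
theorem periodic_matrix_of_abelian_of_jacobson_nil (R : Type*) [Ring R]
    (hab : ∀ e : R, e * e = e → ∀ x : R, e * x = x * e)
    (hper : IsPeriodicRing R) (n : ℕ) (hn : 0 < n)
    (hJ : ∀ A ∈ Ideal.jacobson (⊥ : Ideal (Matrix (Fin n) (Fin n) R)), IsNilpotent A) :
    IsPeriodicRing (Matrix (Fin n) (Fin n) R) := by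
  intro A
  let J := Ideal.jacobson (⊥ : Ideal R)
  let : CommRing (R ⧸ J) :=
    { (inferInstance : Ring (R ⧸ J)) with
      mul_comm := fun a b ↦ by
        obtain ⟨x, rfl⟩ := Ideal.Quotient.mk_surjective a
        obtain ⟨y, rfl⟩ := Ideal.Quotient.mk_surjective b
        rw [← map_mul, ← map_mul]
        exact Ideal.Quotient.eq.mpr (hper.mul_sub_mul_mem_jacobson hab x y) }
  let π : R →+* R ⧸ J := Ideal.Quotient.mk J
  have hT : IsPeriodicRing (R ⧸ J) := hper.of_surjective π Ideal.Quotient.mk_surjective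
  obtain ⟨m, k, -, hkm, h⟩ := hT.matrix_of_commRing (Fin n) (π.mapMatrix A)
  have hmem : A ^ m - A ^ k ∈ Ideal.jacobson (⊥ : Ideal (Matrix (Fin n) (Fin n) R)) := by
    rw [← Ideal.matrix_bot]
    refine Ideal.matrix_jacobson_le _ fun i j ↦ ?_
    rw [← map_pow, ← map_pow] at h
    exact Ideal.Quotient.eq.mp (congrFun (congrFun h i) j)
  obtain ⟨c, hc, hcR⟩ := hper.exists_natCast_eq_zero
  refine (isIntegral_int_of_isNilpotent_pow_sub_pow hkm (hJ _ hmem)).exists_pow_eq_pow hc ?_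
  rw [← map_natCast (Matrix.scalar (Fin n)), hcR, map_zero]
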